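/- Let n ≥ 1, let P be a finite bounded graded poset of rank n+1 with a finite group G acting on it by order-preserving bijections, let t be a positive integer, and let R be the bounded graded poset of rank n+1 obtained by adjoining a new minimum and a new maximum to P̄ ∗ T_{t,n−1}. Then for every S ⊆ [n] and every g ∈ G: α_R(S)(g) = ψ_t(S) · α_P(S)(g), where for S = {s₁ < s₂ < ⋯ < s_k}, ψ_t(S) := [s₁]_t [s₂−s₁+1]_t ⋯ [s_k−s_{k−1}+1]_t (and ψ_t(∅) = 1). -/

import Mathlib

/-!
STATEMENT 3: Let n ≥ 1, P a finite bounded graded poset of rank n+1 with a finite group G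
acting by order-preserving bijections, t a positive integer, and R the bounded graded poset
of rank n+1 obtained by adjoining a new minimum and maximum to P̄ ∗ T_{t,n−1}.  Then for
every S ⊆ [n] and every g ∈ G: α_R(S)(g) = ψ_t(S) · α_P(S)(g).
-/

noncomputable section

/-- The number of maximal chains of the subposet of `(X, r)` induced on `A`, all of whose
elements satisfy the predicate `fix`.  A maximal chain of the subposet on `A` is a chain
`C ⊆ A` not properly contained in any other chain contained in `A`. -/
def nFixedMaxChains {X : Type} (r : X → X → Prop) (A : Set X) (fix : X → Prop) : ℕ :=
  Nat.card {C : Set X // C ⊆ A ∧ IsChain r C ∧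
    (∀ C' : Set X, C' ⊆ A → IsChain r C' → C ⊆ C' → C' = C) ∧ ∀ x ∈ C, fix x}

/-- `α_P(S)(g)`: the number of maximal chains of the rank-selected subposet
`P_S = {x ∈ P : rk x ∈ S} ∪ {⊥, ⊤}` that are fixed pointwise by `g`. -/
def alphaP (P : Type) [PartialOrder P] [BoundedOrder P]
    (G : Type) [Group G] [MulAction G P] (rk : P → ℕ) (S : Finset ℕ) (g : G) : ℕ :=
  nFixedMaxChains (· ≤ · : P → P → Prop) {x : P | rk x ∈ S ∨ x = ⊥ ∨ x = ⊤}
    (fun x => g • x = x)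

/-- `β_P(S)(g) = Σ_{T ⊆ S} (−1)^{|S∖T|} α_P(T)(g)`. -/
def betaP (P : Type) [PartialOrder P] [BoundedOrder P]
    (G : Type) [Group G] [MulAction G P] (rk : P → ℕ) (S : Finset ℕ) (g : G) : ℤ :=
  ∑ T ∈ S.powerset, (-1 : ℤ) ^ ((S \ T).card) * (alphaP P G rk T g : ℤ)

/-- The Rees-product order relation on pairs `(p, q)` of an element of `P` and a word `q`
(an element of `T_{t,·}`, ranked by its length): `(p₁,q₁) ⪯ (p₂,q₂)` iff `p₁ ≤ p₂`, `q₁` is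
a prefix of `q₂`, and the rank differences satisfy
`ρ(p₂) − ρ(p₁) ≥ ρ(q₂) − ρ(q₁)` (stated additively; for `P̄` the rank function is
`rk − 1`, and the shift cancels in the difference). -/
def reesLe (P : Type) [PartialOrder P] (rk : P → ℕ) {t : ℕ}
    (a b : P × List (Fin t)) : Prop :=
  a.1 ≤ b.1 ∧ a.2 <+: b.2 ∧ rk a.1 + b.2.length ≤ rk b.1 + a.2.length

/-- The underlying type of `P̄ ∗ T_{t,n−1}`: pairs `(p, q)` with `⊥ ≠ p ≠ ⊤`, `q` a word of
length ≤ n−1 over a `t`-letter alphabet with `length q ≤ rk p − 1` (the rank of `p` in `P̄`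
being `rk p − 1`, stated additively). -/
abbrev RCore (P : Type) [PartialOrder P] [BoundedOrder P] (rk : P → ℕ) (t n : ℕ) : Type :=
  {pq : P × List (Fin t) // pq.1 ≠ ⊤ ∧ pq.1 ≠ ⊥ ∧ pq.2.length ≤ n - 1 ∧
    pq.2.length + 1 ≤ rk pq.1}

/-- The poset `R` obtained from `P̄ ∗ T_{t,n−1}` by adjoining a new minimum (`none`) and a
new maximum (`some none`). -/
abbrev RType (P : Type) [PartialOrder P] [BoundedOrder P] (rk : P → ℕ) (t n : ℕ) : Type :=
  Option (Option (RCore P rk t n))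

/-- The order relation of `R`. -/
def RLe (P : Type) [PartialOrder P] [BoundedOrder P] (rk : P → ℕ) (t n : ℕ) :
    RType P rk t n → RType P rk t n → Prop
  | none, _ => True
  | some none, b => b = some none
  | some (some _), none => False
  | some (some _), some none => True
  | some (some c), some (some c') => reesLe P rk c.val c'.val

/-- The rank function of `R` (a bounded graded poset of rank `n+1`): the new minimum has
rank 0, the new maximum rank `n+1`, and a core element `(p,q)` has rank
`(rk p − 1) + 1 = rk p`. -/
def RRank (P : Type) [PartialOrder P] [BoundedOrder P] (rk : P → ℕ) (t n : ℕ) :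
    RType P rk t n → ℕ
  | none => 0
  | some none => n + 1
  | some (some c) => rk c.val.1

/-- The fixed-point predicate on `R` for the induced `G`-action `g • (p, q) = (g • p, q)`:
the new minimum and maximum are fixed, and a core element `(p,q)` is fixed iff `g • p = p`. -/
def RFix (P : Type) [PartialOrder P] [BoundedOrder P]
    (G : Type) [Group G] [MulAction G P] (rk : P → ℕ) (t n : ℕ) (g : G) :
    RType P rk t n → Prop
  | some (some c) => g • c.val.1 = c.val.1
  | _ => True

/-- `α_R(S)(g)` for the poset `R`. -/
def alphaR (P : Type) [PartialOrder P] [BoundedOrder P]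
    (G : Type) [Group G] [MulAction G P] (rk : P → ℕ) (t n : ℕ) (S : Finset ℕ) (g : G) : ℕ :=
  nFixedMaxChains (RLe P rk t n)
    {x : RType P rk t n | RRank P rk t n x ∈ S ∨ x = none ∨ x = some none}
    (RFix P G rk t n g)

/-- `β_R(S)(g)`. -/
def betaR (P : Type) [PartialOrder P] [BoundedOrder P]
    (G : Type) [Group G] [MulAction G P] (rk : P → ℕ) (t n : ℕ) (S : Finset ℕ) (g : G) : ℤ :=
  ∑ T ∈ S.powerset, (-1 : ℤ) ^ ((S \ T).card) * (alphaR P G rk t n T g : ℤ)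

/-- `[m]_t = 1 + t + ⋯ + t^{m-1}` as a polynomial in the indeterminate `t` over `ℤ`. -/
def qt (m : ℕ) : Polynomial ℤ := ∑ i ∈ Finset.range m, Polynomial.X ^ i

/-- Helper: given the previous element `prev` and the (sorted, increasing) list of remaining
elements `s₁ < s₂ < ⋯`, returns `[s₁ - prev + 1]_t [s₂ - s₁ + 1]_t ⋯`. -/
def phiAux : ℕ → List ℕ → Polynomial ℤ
  | _, [] => 1
  | prev, s :: rest => qt (s - prev + 1) * phiAux s rest

/-- `ψ_t(S) = [s₁]_t [s₂−s₁+1]_t ⋯ [s_k−s_{k−1}+1]_t` for `S = {s₁ < s₂ < ⋯ < s_k}`,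
with `ψ_t(∅) = 1`. -/
def psi (S : Finset ℕ) : Polynomial ℤ :=
  match S.sort (· ≤ ·) with
  | [] => 1
  | s :: rest => qt s * phiAux s rest

section RankedChains

variable {X : Type} {r : X → X → Prop} {ρ : X → ℕ}

/-- Families `f` choosing one element of each rank in `T`, increasing along `r` and satisfying
`fix`; outside `T` the family takes the fixed value `b`. -/
def rankSections (r : X → X → Prop) (ρ : X → ℕ) (T : Finset ℕ) (fix : X → Prop) (b : X) :
    Set (ℕ → X) :=
  {f | (∀ s ∉ T, f s = b) ∧ (∀ s ∈ T, ρ (f s) = s ∧ fix (f s)) ∧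
    ∀ s ∈ T, ∀ s' ∈ T, s ≤ s' → r (f s) (f s')}

theorem eq_of_isChain_of_rank_eq (hstrict : ∀ x y, r x y → x ≠ y → ρ x < ρ y) {C : Set X}
    (hC : IsChain r C) {x y : X} (hx : x ∈ C) (hy : y ∈ C) (h : ρ x = ρ y) : x = y := by
  by_contra hne
  rcases hC hx hy hne with h' | h'
  · exact (hstrict _ _ h' hne).ne h
  · exact (hstrict _ _ h' (Ne.symm hne)).ne h.symm

theorem rel_of_isChain_of_rank_le (hrefl : ∀ x, r x x)
    (hstrict : ∀ x y, r x y → x ≠ y → ρ x < ρ y) {C : Set X}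
    (hC : IsChain r C) {x y : X} (hx : x ∈ C) (hy : y ∈ C) (h : ρ x ≤ ρ y) : r x y := by
  by_cases hne : x = y
  · exact hne ▸ hrefl x
  rcases hC hx hy hne with h' | h'
  · exact h'
  · exact absurd (hstrict _ _ h' (Ne.symm hne)) (by omega)

theorem exists_mem_rank_eq_of_maximal_chain {T : Finset ℕ} {N : ℕ} {b m : X}
    (hrefl : ∀ x, r x x) (htrans : ∀ x y z, r x y → r y z → r x z)
    (hstrict : ∀ x y, r x y → x ≠ y → ρ x < ρ y)
    (h0 : 0 ∈ T) (hN : N ∈ T) (hTN : ∀ s ∈ T, s ≤ N)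
    (hb : ρ b = 0) (hbot : ∀ x, r b x) (hm : ρ m = N) (htop : ∀ x, r x m)
    (hmid : ∀ x y s, r x y → ρ x < s → s < ρ y → ∃ z, ρ z = s ∧ r x z ∧ r z y)
    {C : Set X} (hCA : C ⊆ {x | ρ x ∈ T}) (hC : IsChain r C)
    (hmax : ∀ C' : Set X, C' ⊆ {x | ρ x ∈ T} → IsChain r C' → C ⊆ C' → C' = C)
    {s : ℕ} (hs : s ∈ T) : ∃ x ∈ C, ρ x = s := by
  have key : ∀ z, ρ z ∈ T → (∀ x ∈ C, r z x ∨ r x z) → z ∈ C := by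
    intro z hz hcomp
    have hEq := hmax (insert z C) (Set.insert_subset hz hCA)
      (hC.insert fun x hx _ => hcomp x hx) (Set.subset_insert _ _)
    exact hEq ▸ Set.mem_insert z C
  have hbC : b ∈ C := key b (by simpa [hb] using h0) fun x _ => Or.inl (hbot x)
  have hmC : m ∈ C := key m (by simpa [hm] using hN) fun x _ => Or.inr (htop x)
  by_contra! hcon
  classical
  have hs0 : 0 < s := Nat.pos_of_ne_zero fun h => hcon b hbC (by omega)
  have hsN : s < N := lt_of_le_of_ne (hTN s hs) fun h => hcon m hmC (by omega)
  obtain ⟨i, hi, himax⟩ := (T.filter fun i => i < s ∧ ∃ x ∈ C, ρ x = i).exists_max_image id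
    ⟨0, by simpa using ⟨h0, hs0, b, hbC, hb⟩⟩
  obtain ⟨j, hj, hjmin⟩ := (T.filter fun i => s < i ∧ ∃ x ∈ C, ρ x = i).exists_min_image id
    ⟨N, by simpa using ⟨hN, hsN, m, hmC, hm⟩⟩
  simp only [Finset.mem_filter, id] at hi hj himax hjmin
  obtain ⟨-, his, x, hxC, rfl⟩ := hi
  obtain ⟨-, hjs, y, hyC, rfl⟩ := hj
  obtain ⟨z, hz, hxz, hzy⟩ := hmid x y s
    (rel_of_isChain_of_rank_le hrefl hstrict hC hxC hyC (by omega)) his hjs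
  refine hcon z (key z (by simpa [hz] using hs) fun c hc => ?_) hz
  rcases lt_trichotomy (ρ c) s with h | h | h
  · exact Or.inr (htrans _ _ _ (rel_of_isChain_of_rank_le hrefl hstrict hC hc hxC
      (himax _ ⟨hCA hc, h, c, hc, rfl⟩)) hxz)
  · exact absurd h (hcon c hc)
  · exact Or.inl (htrans _ _ _ hzy (rel_of_isChain_of_rank_le hrefl hstrict hC hyC hc
      (hjmin _ ⟨hCA hc, h, c, hc, rfl⟩)))

theorem nFixedMaxChains_eq_card_rankSections {T : Finset ℕ} {N : ℕ} {b m : X} (fix : X → Prop)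
    (hrefl : ∀ x, r x x) (htrans : ∀ x y z, r x y → r y z → r x z)
    (hstrict : ∀ x y, r x y → x ≠ y → ρ x < ρ y)
    (h0 : 0 ∈ T) (hN : N ∈ T) (hTN : ∀ s ∈ T, s ≤ N)
    (hb : ρ b = 0) (hbot : ∀ x, r b x) (hm : ρ m = N) (htop : ∀ x, r x m)
    (hmid : ∀ x y s, r x y → ρ x < s → s < ρ y → ∃ z, ρ z = s ∧ r x z ∧ r z y) :
    nFixedMaxChains r {x | ρ x ∈ T} fix = Nat.card (rankSections r ρ T fix b) := by
  have hchain : ∀ f ∈ rankSections r ρ T fix b, IsChain r (f '' T) := by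
    rintro f ⟨-, -, hf⟩ _ ⟨s, hs, rfl⟩ _ ⟨s', hs', rfl⟩ -
    exact (le_total s s').imp (hf s hs s' hs') (hf s' hs' s hs)
  symm
  refine Nat.card_congr (Equiv.ofBijective (fun f => ⟨f.1 '' T, ?_, hchain f.1 f.2, ?_, ?_⟩)
    ⟨?_, ?_⟩)
  · rintro _ ⟨s, hs, rfl⟩
    simpa [(f.2.2.1 s hs).1] using hs
  · intro C' hC'A hC' hsub
    refine (Set.Subset.antisymm hsub fun x hx => ⟨ρ x, hC'A hx, ?_⟩).symm
    exact eq_of_isChain_of_rank_eq hstrict hC' (hsub ⟨ρ x, hC'A hx, rfl⟩) hx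
      (f.2.2.1 _ (hC'A hx)).1
  · rintro _ ⟨s, hs, rfl⟩
    exact (f.2.2.1 s hs).2
  · rintro ⟨f, hf⟩ ⟨f', hf'⟩ h
    have himg : f '' (T : Set ℕ) = f' '' T := congrArg Subtype.val h
    ext s
    by_cases hs : s ∈ T
    · obtain ⟨s', hs', he⟩ : f s ∈ f' '' (T : Set ℕ) := himg ▸ ⟨s, hs, rfl⟩
      have : s' = s := by rw [← (hf'.2.1 s' hs').1, he, (hf.2.1 s hs).1]
      exact (this ▸ he).symm
    · exact (hf.1 s hs).trans (hf'.1 s hs).symm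
  · rintro ⟨C, hCA, hC, hmax, hfix⟩
    classical
    have hex : ∀ s ∈ T, ∃ x ∈ C, ρ x = s := fun s hs =>
      exists_mem_rank_eq_of_maximal_chain hrefl htrans hstrict h0 hN hTN hb hbot hm htop hmid
        hCA hC hmax hs
    have : Nonempty X := ⟨b⟩
    choose! e heC heρ using hex
    have heT : ∀ s ∈ T, (if s ∈ T then e s else b) = e s := fun s hs => if_pos hs
    refine ⟨⟨fun s => if s ∈ T then e s else b, fun s hs => if_neg hs, fun s hs => ?_,
      fun s hs s' hs' hle => ?_⟩, Subtype.ext (Set.Subset.antisymm ?_ fun x hx => ?_)⟩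
    · dsimp only
      rw [heT s hs]
      exact ⟨heρ s hs, hfix _ (heC s hs)⟩
    · dsimp only
      rw [heT s hs, heT s' hs']
      exact rel_of_isChain_of_rank_le hrefl hstrict hC (heC s hs) (heC s' hs')
        (by rwa [heρ s hs, heρ s' hs'])
    · rintro _ ⟨s, hs, rfl⟩
      dsimp only
      rw [heT s hs]
      exact heC s hs
    · refine ⟨ρ x, hCA hx, ?_⟩
      dsimp only
      rw [heT _ (hCA hx)]
      exact eq_of_isChain_of_rank_eq hstrict hC (heC _ (hCA hx)) hx (heρ _ (hCA hx))

end RankedChains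

section Words

variable {t : ℕ}

/-- The Rees-product condition on words `a`, `a'` placed at ranks `s`, `s'`. -/
def WordStep (s : ℕ) (a : List (Fin t)) (s' : ℕ) (a' : List (Fin t)) : Prop :=
  a <+: a' ∧ s + a'.length ≤ s' + a.length

theorem WordStep.trans {s s' s'' : ℕ} {a a' a'' : List (Fin t)} (h : WordStep s a s' a')
    (h' : WordStep s' a' s'' a'') : WordStep s a s'' a'' :=
  ⟨h.1.trans h'.1, by have := h.2; have := h'.2; omega⟩

/-- Families of words indexed by `S` forming a chain above the word `a` placed at rank `c`. -/
def wordSections (c : ℕ) (a : List (Fin t)) (S : Finset ℕ) : Set (ℕ → List (Fin t)) :=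
  {w | (∀ s ∉ S, w s = []) ∧ (∀ s ∈ S, WordStep c a s (w s)) ∧
    ∀ s ∈ S, ∀ s' ∈ S, s ≤ s' → WordStep s (w s) s' (w s')}

theorem finite_wordStep (c : ℕ) (a : List (Fin t)) (s : ℕ) :
    Finite {q : List (Fin t) // WordStep c a s q} :=
  (List.finite_length_le (Fin t) (s + a.length)).subset fun q hq => by
    have := hq.2
    simp only [Set.mem_ofPred_eq]
    omega

theorem card_wordStep {c s : ℕ} (a : List (Fin t)) (h : c ≤ s) :
    Nat.card {q : List (Fin t) // WordStep c a s q} = ∑ i ∈ Finset.range (s - c + 1), t ^ i := by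
  let e : (Σ i : Fin (s - c + 1), List.Vector (Fin t) i) ≃
      {q : List (Fin t) // WordStep c a s q} :=
    Equiv.ofBijective
      (fun u => ⟨a ++ u.2.1, List.prefix_append _ _, by
        have := u.1.2; have := u.2.2; simp only [List.length_append]; omega⟩) (by
      refine ⟨?_, ?_⟩
      · rintro ⟨⟨i, hi⟩, ⟨u, hu⟩⟩ ⟨⟨j, hj⟩, ⟨v, hv⟩⟩ h
        obtain rfl : u = v := List.append_cancel_left (congrArg Subtype.val h)
        obtain rfl : i = j := hu.symm.trans hv
        rfl
      · rintro ⟨q, ⟨u, rfl⟩, hq⟩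
        rw [List.length_append] at hq
        exact ⟨⟨⟨u.length, by omega⟩, ⟨u, rfl⟩⟩, rfl⟩)
  rw [← Nat.card_congr e, Nat.card_eq_fintype_card, Fintype.card_sigma,
    ← Fin.sum_univ_eq_sum_range (fun i => t ^ i)]
  simp

/-- A chain of words indexed by `insert m S` is a word at the least index `m` followed by a chain
above it indexed by `S`. -/
def wordSectionsInsertEquiv {c m : ℕ} (a : List (Fin t)) {S : Finset ℕ} (hS : ∀ s ∈ S, m < s) :
    wordSections c a (insert m S) ≃
      Σ q : {q : List (Fin t) // WordStep c a m q}, wordSections m q.1 S where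
  toFun w := ⟨⟨w.1 m, w.2.2.1 m (by simp)⟩, ⟨Function.update w.1 m [], by
    have hne : ∀ s ∈ S, s ≠ m := fun s hs => (hS s hs).ne'
    refine ⟨fun s hs => ?_, fun s hs => ?_, fun s hs s' hs' hle => ?_⟩
    · by_cases h : s = m
      · simp [h]
      · rw [Function.update_of_ne h]
        exact w.2.1 s (by simp [h, hs])
    · rw [Function.update_of_ne (hne s hs)]
      exact w.2.2.2 m (by simp) s (by simp [hs]) (hS s hs).le
    · rw [Function.update_of_ne (hne s hs), Function.update_of_ne (hne s' hs')]
      exact w.2.2.2 s (by simp [hs]) s' (by simp [hs']) hle⟩⟩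
  invFun u := ⟨Function.update u.2.1 m u.1.1, by
    have hne : ∀ s ∈ S, s ≠ m := fun s hs => (hS s hs).ne'
    refine ⟨fun s hs => ?_, fun s hs => ?_, fun s hs s' hs' hle => ?_⟩
    · rw [Finset.mem_insert, not_or] at hs
      rw [Function.update_of_ne hs.1]
      exact u.2.2.1 s hs.2
    · rcases Finset.mem_insert.1 hs with rfl | hs
      · rw [Function.update_self]
        exact u.1.2
      · rw [Function.update_of_ne (hne s hs)]
        exact u.1.2.trans (u.2.2.2.1 s hs)
    · rcases Finset.mem_insert.1 hs with rfl | h <;> rcases Finset.mem_insert.1 hs' with rfl | h'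
      · exact ⟨List.prefix_rfl, le_rfl⟩
      · rw [Function.update_self, Function.update_of_ne (hne s' h')]
        exact u.2.2.2.1 s' h'
      · exact absurd (hS s h) (by omega)
      · rw [Function.update_of_ne (hne s h), Function.update_of_ne (hne s' h')]
        exact u.2.2.2.2 s h s' h' hle⟩
  left_inv w := by simp
  right_inv := by
    rintro ⟨⟨q, hq⟩, ⟨w, hw⟩⟩
    have hm : w m = [] := hw.1 m fun h => (hS m h).false
    have hu : Function.update w m [] = w := by rw [← hm, Function.update_eq_self]
    have hsigma : ∀ q' (hq' : WordStep c a m q') w' (hw' : w' ∈ wordSections m q' S), q' = q →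
        w' = w → (⟨⟨q', hq'⟩, ⟨w', hw'⟩⟩ :
          Σ q : {q : List (Fin t) // WordStep c a m q}, wordSections m q.1 S) =
            ⟨⟨q, hq⟩, ⟨w, hw⟩⟩ := by
      rintro _ _ _ _ rfl rfl
      rfl
    exact hsigma _ _ _ _ (Function.update_self ..) (by rw [Function.update_idem, hu])

theorem eval_qt (m : ℕ) :
    (qt m).eval (t : ℤ) = ((∑ i ∈ Finset.range m, t ^ i : ℕ) : ℤ) := by
  simp [qt, Polynomial.eval_finsetSum]

theorem finite_and_card_wordSections (l : List ℕ) (hl : l.Pairwise (· < ·)) (c : ℕ)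
    (hc : ∀ s ∈ l, c ≤ s) (a : List (Fin t)) :
    Finite (wordSections c a l.toFinset) ∧
      (Nat.card (wordSections c a l.toFinset) : ℤ) = (phiAux c l).eval (t : ℤ) := by
  induction l generalizing c a with
  | nil =>
    have h : wordSections c a ([] : List ℕ).toFinset = {fun _ => []} := by
      ext w
      simp [wordSections, funext_iff]
    rw [h]
    exact ⟨inferInstance, by simp [phiAux]⟩
  | cons m l ih =>
    rw [List.pairwise_cons] at hl
    have ih' := fun q : List (Fin t) => ih hl.2 m (fun s hs => (hl.1 s hs).le) q
    have := finite_wordStep c a m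
    have := fun q : {q : List (Fin t) // WordStep c a m q} => (ih' q.1).1
    have e := wordSectionsInsertEquiv (c := c) a (S := l.toFinset) (m := m) (by simpa using hl.1)
    rw [List.toFinset_cons]
    refine ⟨Finite.of_equiv _ e.symm, ?_⟩
    have := Fintype.ofFinite {q : List (Fin t) // WordStep c a m q}
    rw [Nat.card_congr e, Nat.card_sigma, Nat.cast_sum,
      Finset.sum_congr rfl fun q _ => (ih' q.1).2, Finset.sum_const, Finset.card_univ,
      ← Nat.card_eq_fintype_card, card_wordStep a (hc m (by simp)), phiAux, Polynomial.eval_mul,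
      eval_qt, nsmul_eq_mul]

theorem eval_psi {n : ℕ} {S : Finset ℕ} (hS : S ⊆ Finset.Icc 1 n) :
    (psi S).eval (t : ℤ) = Nat.card (wordSections (t := t) 1 [] S) := by
  have h1 : ∀ s ∈ S.sort (· ≤ ·), 1 ≤ s := fun s hs =>
    (Finset.mem_Icc.1 (hS ((Finset.mem_sort _).1 hs))).1
  have h := (finite_and_card_wordSections (t := t) (S.sort (· ≤ ·))
    (Finset.sortedLT_sort S).pairwise 1 h1 []).2
  rw [Finset.sort_toFinset] at h
  rw [h, psi]
  split
  · next h' => rw [h', phiAux]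
  · next s l h' =>
    have : 1 ≤ s := h1 s (by simp [h'])
    rw [h', phiAux, Nat.sub_add_cancel this]

end Words

section GradedPoset

variable {P : Type} [Finite P] [PartialOrder P] {rk : P → ℕ}

theorem rank_lt_of_lt (hgraded : ∀ x y : P, x ⋖ y → rk y = rk x + 1) {x y : P} (h : x < y) :
    rk x < rk y := by
  induction x using WellFoundedGT.induction with
  | ind x ih =>
    obtain ⟨z, hxz, hzy⟩ := exists_covBy_le_of_lt h
    have := hgraded x z hxz
    rcases hzy.eq_or_lt with rfl | hlt
    · omega
    · have := ih z hxz.lt hlt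
      omega

theorem exists_rank_eq_between (hgraded : ∀ x y : P, x ⋖ y → rk y = rk x + 1) {x y : P}
    (h : x ≤ y) {s : ℕ} (hx : rk x ≤ s) (hy : s ≤ rk y) : ∃ z, rk z = s ∧ x ≤ z ∧ z ≤ y := by
  induction x using WellFoundedGT.induction with
  | ind x ih =>
    by_cases hs : rk x = s
    · exact ⟨x, hs, le_rfl, h⟩
    obtain ⟨z, hxz, hzy⟩ := exists_covBy_le_of_lt
      (lt_of_le_of_ne h (by rintro rfl; omega))
    have := hgraded x z hxz
    obtain ⟨u, hu, hzu, huy⟩ := ih z hxz.lt hzy (by omega)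
    exact ⟨u, hu, hxz.le.trans hzu, huy⟩

end GradedPoset

section ReesProduct

variable {P : Type} [PartialOrder P] [BoundedOrder P] {rk : P → ℕ} {t n : ℕ}

theorem RLe_refl (x : RType P rk t n) : RLe P rk t n x x := by
  rcases x with _ | _ | c
  · trivial
  · rfl
  · exact ⟨le_rfl, List.prefix_rfl, le_rfl⟩

theorem RLe_trans (x y z : RType P rk t n) (hxy : RLe P rk t n x y) (hyz : RLe P rk t n y z) :
    RLe P rk t n x z := by
  rcases x with _ | _ | x <;> rcases y with _ | _ | y <;> rcases z with _ | _ | z <;>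
    simp only [RLe, reesLe, reduceCtorEq, Option.some.injEq] at hxy hyz ⊢
  refine ⟨hxy.1.trans hyz.1, hxy.2.1.trans hyz.2.1, ?_⟩
  omega

theorem rank_eq_zero_iff_eq_bot [Finite P] (hrk_bot : rk ⊥ = 0)
    (hgraded : ∀ x y : P, x ⋖ y → rk y = rk x + 1) (x : P) : rk x = 0 ↔ x = ⊥ := by
  refine ⟨fun h => ?_, fun h => h ▸ hrk_bot⟩
  by_contra hne
  have := rank_lt_of_lt hgraded (bot_lt_iff_ne_bot.2 hne)
  omega

theorem rank_lt_of_ne_top [Finite P] (hrk_top : rk ⊤ = n + 1)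
    (hgraded : ∀ x y : P, x ⋖ y → rk y = rk x + 1) {x : P} (hx : x ≠ ⊤) : rk x < n + 1 :=
  hrk_top ▸ rank_lt_of_lt hgraded (lt_top_iff_ne_top.2 hx)

theorem rank_eq_top_iff_eq_top [Finite P] (hrk_top : rk ⊤ = n + 1)
    (hgraded : ∀ x y : P, x ⋖ y → rk y = rk x + 1) (x : P) : rk x = n + 1 ↔ x = ⊤ := by
  refine ⟨fun h => ?_, fun h => h ▸ hrk_top⟩
  by_contra hne
  have := rank_lt_of_ne_top hrk_top hgraded hne
  omega

theorem RRank_lt [Finite P] (hrk_top : rk ⊤ = n + 1)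
    (hgraded : ∀ x y : P, x ⋖ y → rk y = rk x + 1) (x y : RType P rk t n)
    (h : RLe P rk t n x y) (hne : x ≠ y) : RRank P rk t n x < RRank P rk t n y := by
  rcases x with _ | _ | ⟨⟨p, q⟩, hp⟩ <;> rcases y with _ | _ | ⟨⟨p', q'⟩, hp'⟩ <;>
    simp only [RLe, RRank, reesLe, reduceCtorEq, Option.some.injEq, ne_eq, not_true] at *
  · omega
  · exact Nat.zero_lt_of_lt hp'.2.2.2
  · exact rank_lt_of_ne_top hrk_top hgraded hp.1
  · rcases h.1.eq_or_lt with rfl | hlt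
    · exact (hne (Subtype.ext (Prod.ext rfl (h.2.1.eq_of_length_le (by omega))))).elim
    · exact rank_lt_of_lt hgraded hlt

theorem exists_RRank_eq_between [Finite P] (hrk_bot : rk ⊥ = 0) (hrk_top : rk ⊤ = n + 1)
    (hgraded : ∀ x y : P, x ⋖ y → rk y = rk x + 1) (x y : RType P rk t n) (s : ℕ)
    (h : RLe P rk t n x y) (hx : RRank P rk t n x < s) (hy : s < RRank P rk t n y) :
    ∃ z, RRank P rk t n z = s ∧ RLe P rk t n x z ∧ RLe P rk t n z y := by
  have core : ∀ (p : P) (q : List (Fin t)), rk p = s → 0 < s → s < n + 1 → q.length + 1 ≤ s →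
      p ≠ ⊤ ∧ p ≠ ⊥ ∧ q.length ≤ n - 1 ∧ q.length + 1 ≤ rk p := by
    rintro p q hp h0 hn hq
    refine ⟨?_, ?_, by omega, by omega⟩ <;> rintro rfl <;> omega
  rcases x with _ | _ | ⟨⟨p, q⟩, hp⟩ <;> rcases y with _ | _ | ⟨⟨p', q'⟩, hp'⟩ <;>
    simp only [RLe, RRank, reesLe, reduceCtorEq, Option.some.injEq] at h hx hy
  · omega
  · obtain ⟨z, hz, -, -⟩ := exists_rank_eq_between hgraded (bot_le (a := (⊤ : P))) (s := s)
      (by omega) (by omega)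
    exact ⟨some (some ⟨(z, []), core z [] hz hx hy hx⟩), hz, trivial, trivial⟩
  · obtain ⟨z, hz, -, hzp⟩ := exists_rank_eq_between hgraded (bot_le (a := p')) (s := s)
      (by omega) (by omega)
    have : rk p' < n + 1 := rank_lt_of_ne_top hrk_top hgraded hp'.1
    have : q'.length + 1 ≤ rk p' := hp'.2.2.2
    refine ⟨some (some ⟨(z, q'.take (s - 1)), core z _ hz hx (by omega) ?_⟩), hz, trivial,
      hzp, List.take_prefix _ _, ?_⟩ <;> simp only [List.length_take] <;> omega
  · omega
  · obtain ⟨z, hz, hpz, -⟩ := exists_rank_eq_between hgraded (le_top (a := p)) (s := s)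
      (by omega) (by omega)
    have : q.length + 1 ≤ rk p := hp.2.2.2
    refine ⟨some (some ⟨(z, q), core z q hz (by omega) (by omega) (by omega)⟩), hz,
      ⟨hpz, List.prefix_rfl, ?_⟩, trivial⟩
    dsimp only
    omega
  · obtain ⟨z, hz, hpz, hzp⟩ := exists_rank_eq_between hgraded h.1 (s := s)
      (by omega) (by omega)
    have : rk p' < n + 1 := rank_lt_of_ne_top hrk_top hgraded hp'.1
    have : q.length + 1 ≤ rk p := hp.2.2.2
    have := h.2.2
    have := h.2.1.length_le
    refine ⟨some (some ⟨(z, q'.take (q.length + s - rk p)), core z _ hz (by omega) (by omega) ?_⟩),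
      hz, ⟨hpz, List.prefix_take_iff.2 ⟨h.2.1, ?_⟩, ?_⟩, hzp, List.take_prefix _ _, ?_⟩ <;>
      simp only [List.length_take] <;> omega

/-- The `P`-component of an element of `R`. -/
def RFst : RType P rk t n → P
  | none => ⊥
  | some none => ⊤
  | some (some c) => c.val.1

/-- The word component of an element of `R`, empty for the adjoined extrema. -/
def RSnd : RType P rk t n → List (Fin t)
  | some (some c) => c.val.2
  | _ => []

open Classical in
/-- The element of `R` with given components, if there is one. -/
def RMk (p : P) (q : List (Fin t)) : RType P rk t n :=
  if p = ⊤ then some none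
  else if h : p ≠ ⊤ ∧ p ≠ ⊥ ∧ q.length ≤ n - 1 ∧ q.length + 1 ≤ rk p then some (some ⟨(p, q), h⟩)
  else none

theorem RMk_bot (hbt : (⊥ : P) ≠ ⊤) (q : List (Fin t)) :
    (RMk ⊥ q : RType P rk t n) = none := by
  simp [RMk, hbt]

theorem RMk_top (q : List (Fin t)) : (RMk ⊤ q : RType P rk t n) = some none := by
  simp [RMk]

theorem RMk_core (c : RCore P rk t n) :
    (RMk c.val.1 c.val.2 : RType P rk t n) = some (some c) := by
  rw [RMk, if_neg c.2.1, dif_pos c.2]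

theorem RMk_RFst_RSnd (hbt : (⊥ : P) ≠ ⊤) (x : RType P rk t n) : RMk (RFst x) (RSnd x) = x := by
  rcases x with _ | _ | c
  · exact RMk_bot hbt _
  · exact RMk_top _
  · exact RMk_core c

theorem rank_RFst (hrk_bot : rk ⊥ = 0) (hrk_top : rk ⊤ = n + 1) (x : RType P rk t n) :
    rk (RFst x) = RRank P rk t n x := by
  rcases x with _ | _ | c
  · exact hrk_bot
  · exact hrk_top
  · rfl

theorem RFst_mono {x y : RType P rk t n} (h : RLe P rk t n x y) : RFst x ≤ RFst y := by
  rcases x with _ | _ | x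
  · exact bot_le
  · cases h
    exact le_rfl
  rcases y with _ | _ | y
  · exact h.elim
  · exact le_top
  · exact h.1

/-- An element of `R` of rank strictly between `0` and `n + 1` is a pair. -/
theorem exists_core_of_RRank {x : RType P rk t n} (h0 : RRank P rk t n x ≠ 0)
    (hn : RRank P rk t n x ≠ n + 1) : ∃ c, x = some (some c) := by
  rcases x with _ | _ | c
  · exact absurd rfl h0
  · exact absurd rfl hn
  · exact ⟨c, rfl⟩

end ReesProduct

section Action

variable {P : Type} [PartialOrder P] [BoundedOrder P] {G : Type} [Group G] [MulAction G P]

theorem smul_bot_of_monotone (hact : ∀ (g : G) (x y : P), x ≤ y → g • x ≤ g • y) (g : G) :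
    g • (⊥ : P) = ⊥ :=
  le_bot_iff.1 (by simpa using hact g ⊥ (g⁻¹ • ⊥) bot_le)

theorem smul_top_of_monotone (hact : ∀ (g : G) (x y : P), x ≤ y → g • x ≤ g • y) (g : G) :
    g • (⊤ : P) = ⊤ :=
  top_le_iff.1 (by simpa using hact g (g⁻¹ • ⊤) ⊤ le_top)

end Action

section Splitting

variable {P : Type} [Finite P] [PartialOrder P] [BoundedOrder P] {rk : P → ℕ} {t n : ℕ}
  {G : Type} [Group G] [MulAction G P]

/-- A section of `R` over `S ∪ {0, n + 1}` is a section of `P` together with a chain of words. -/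
def rankSectionsEquivProd (hrk_bot : rk ⊥ = 0) (hrk_top : rk ⊤ = n + 1)
    (hgraded : ∀ x y : P, x ⋖ y → rk y = rk x + 1)
    (hact : ∀ (g : G) (x y : P), x ≤ y → g • x ≤ g • y)
    {S : Finset ℕ} (hS : S ⊆ Finset.Icc 1 n) (g : G) :
    rankSections (RLe P rk t n) (RRank P rk t n) (insert 0 (insert (n + 1) S))
        (RFix P G rk t n g) none ≃
      wordSections (t := t) 1 [] S ×
        rankSections (· ≤ ·) rk (insert 0 (insert (n + 1) S)) (fun x : P => g • x = x) ⊥ := by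
  have hbt : (⊥ : P) ≠ ⊤ := fun h => by rw [h, hrk_top] at hrk_bot; omega
  have hS1 : ∀ s ∈ S, 1 ≤ s ∧ s ≤ n := fun s hs => Finset.mem_Icc.1 (hS hs)
  have hmemT : ∀ s ∈ S, s ∈ insert 0 (insert (n + 1) S) := fun s hs => by simp [hs]
  have hcore : ∀ (p : ℕ → P) (w : ℕ → List (Fin t)),
      p ∈ rankSections (· ≤ ·) rk (insert 0 (insert (n + 1) S)) (fun x : P => g • x = x) ⊥ →
      w ∈ wordSections 1 [] S → ∀ s ∈ S, ∃ c : RCore P rk t n, c.val = (p s, w s) := by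
    intro p w hp hw s hs
    have hr := (hp.2.1 s (hmemT s hs)).1
    have h1 := hS1 s hs
    have hl := (hw.2.1 s hs).2
    rw [List.length_nil] at hl
    refine ⟨⟨(p s, w s), ?_, ?_, ?_, ?_⟩, rfl⟩
    · intro h
      dsimp only at h
      rw [h] at hr
      omega
    · intro h
      dsimp only at h
      rw [h] at hr
      omega
    · dsimp only
      omega
    · dsimp only
      omega
  have hext : ∀ p ∈ rankSections (· ≤ ·) rk (insert 0 (insert (n + 1) S))
      (fun x : P => g • x = x) ⊥, ∀ s ∉ S, p s = ⊥ ∨ (p s = ⊤ ∧ s = n + 1) := by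
    intro p hp s hs
    by_cases h0 : s = 0
    · subst h0
      exact Or.inl ((rank_eq_zero_iff_eq_bot hrk_bot hgraded _).1 (hp.2.1 0 (by simp)).1)
    by_cases hn : s = n + 1
    · subst hn
      exact Or.inr ⟨(rank_eq_top_iff_eq_top hrk_top hgraded _).1 (hp.2.1 _ (by simp)).1, rfl⟩
    · exact Or.inl (hp.1 s (by simp [h0, hn, hs]))
  have hmk : ∀ (p : ℕ → P) (w : ℕ → List (Fin t)),
      p ∈ rankSections (· ≤ ·) rk (insert 0 (insert (n + 1) S)) (fun x : P => g • x = x) ⊥ →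
      w ∈ wordSections 1 [] S → ∀ s, RFst (RMk (p s) (w s) : RType P rk t n) = p s ∧
        RSnd (RMk (p s) (w s) : RType P rk t n) = w s := by
    intro p w hp hw s
    by_cases hs : s ∈ S
    · obtain ⟨c, hc⟩ := hcore p w hp hw s hs
      have : (RMk (p s) (w s) : RType P rk t n) = some (some c) := by
        rw [← RMk_core c, hc]
      rw [this]
      exact ⟨congrArg Prod.fst hc, congrArg Prod.snd hc⟩
    · rw [hw.1 s hs]
      rcases hext p hp s hs with h | ⟨h, -⟩
      · rw [h, RMk_bot hbt]
        exact ⟨rfl, rfl⟩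
      · rw [h, RMk_top]
        exact ⟨rfl, rfl⟩
  exact
  { toFun := fun f => by
      have hcS : ∀ s ∈ S, ∃ c, f.1 s = some (some c) := fun s hs => by
        have h := (f.2.2.1 s (hmemT s hs)).1
        have := hS1 s hs
        exact exists_core_of_RRank (by omega) (by omega)
      have hrank := fun s hs => (f.2.2.1 s (hmemT s hs)).1
      refine ⟨⟨fun s => RSnd (f.1 s), fun s hs => ?_, fun s hs => ⟨List.nil_prefix, ?_⟩,
          fun s hs s' hs' hle => ?_⟩,
        ⟨fun s => RFst (f.1 s), fun s hs => ?_, fun s hs => ⟨?_, ?_⟩,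
          fun s hs s' hs' hle => RFst_mono (f.2.2.2 s hs s' hs' hle)⟩⟩
      · rcases hfs : f.1 s with _ | _ | c
        · simp only [hfs, RSnd]
        · simp only [hfs, RSnd]
        · by_cases hT : s ∈ insert 0 (insert (n + 1) S)
          · have hr := (f.2.2.1 s hT).1
            rw [hfs, RRank] at hr
            have := c.2.2.2.2
            have := rank_lt_of_ne_top hrk_top hgraded c.2.1
            simp only [Finset.mem_insert, hs, or_false] at hT
            omega
          · have := f.2.1 s hT
            rw [hfs] at this
            cases this
      · obtain ⟨c, hc⟩ := hcS s hs
        have := hrank s hs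
        rw [hc, RRank] at this
        have := c.2.2.2.2
        simp only [hc, RSnd, List.length_nil]
        omega
      · obtain ⟨c, hc⟩ := hcS s hs
        obtain ⟨c', hc'⟩ := hcS s' hs'
        have h := f.2.2.2 s (hmemT s hs) s' (hmemT s' hs') hle
        have h1 := hrank s hs
        have h2 := hrank s' hs'
        rw [hc, RRank] at h1
        rw [hc', RRank] at h2
        rw [hc, hc', RLe] at h
        simp only [hc, hc', RSnd]
        refine ⟨h.2.1, ?_⟩
        have := h.2.2
        omega
      · simp only [f.2.1 s hs, RFst]
      · rw [rank_RFst hrk_bot hrk_top]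
        exact (f.2.2.1 s hs).1
      · have h := (f.2.2.1 s hs).2
        change g • RFst (f.1 s) = RFst (f.1 s)
        rcases hfs : f.1 s with _ | _ | c
        · exact smul_bot_of_monotone hact g
        · exact smul_top_of_monotone hact g
        · rw [hfs] at h
          exact h
    invFun := fun u => ⟨fun s => RMk (u.2.1 s) (u.1.1 s), by
      obtain ⟨⟨w, hw⟩, ⟨p, hp⟩⟩ := u
      refine ⟨fun s hs => ?_, fun s hs => ⟨?_, ?_⟩, fun s hs s' hs' hle => ?_⟩
      · dsimp only
        rw [hp.1 s hs, RMk_bot hbt]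
      · rw [← rank_RFst hrk_bot hrk_top, (hmk p w hp hw s).1]
        exact (hp.2.1 s hs).1
      · have h := (hp.2.1 s hs).2
        have h' := (hmk p w hp hw s).1
        dsimp only at h ⊢
        rcases hfs : (RMk (p s) (w s) : RType P rk t n) with _ | _ | c
        · trivial
        · trivial
        · rw [hfs] at h'
          rw [← h'] at h
          exact h
      · have hle' := hp.2.2 s hs s' hs' hle
        have h := hp.2.1 s hs
        have h' := hp.2.1 s' hs'
        dsimp only at hle' ⊢
        by_cases hsS : s ∈ S
        · by_cases hsS' : s' ∈ S
          · obtain ⟨c, hc⟩ := hcore p w hp hw s hsS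
            obtain ⟨c', hc'⟩ := hcore p w hp hw s' hsS'
            have e : (RMk (p s) (w s) : RType P rk t n) = some (some c) := by
              rw [← RMk_core c, hc]
            have e' : (RMk (p s') (w s') : RType P rk t n) = some (some c') := by
              rw [← RMk_core c', hc']
            rw [e, e', RLe, hc, hc']
            have hst := hw.2.2 s hsS s' hsS' hle
            refine ⟨hle', hst.1, ?_⟩
            dsimp only
            rw [h.1, h'.1]
            exact hst.2
          · rcases hext p hp s' hsS' with e | ⟨e, -⟩
            · rw [e, hrk_bot] at h'
              have := hS1 s hsS
              omega
            · rw [e, RMk_top]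
              rcases (RMk (p s) (w s) : RType P rk t n) with _ | _ | c
              · trivial
              · rfl
              · trivial
        · rcases hext p hp s hsS with e | ⟨e, rfl⟩
          · rw [e, RMk_bot hbt]
            trivial
          · have e' : p s' = ⊤ := top_le_iff.1 (e ▸ hle')
            rw [e, e', RMk_top, RMk_top]
            exact RLe_refl _⟩
    left_inv := fun f => Subtype.ext (funext fun s => RMk_RFst_RSnd hbt (f.1 s))
    right_inv := fun u => Prod.ext
      (Subtype.ext (funext fun s => (hmk u.2.1 u.1.1 u.2.2 u.1.2 s).2))
      (Subtype.ext (funext fun s => (hmk u.2.1 u.1.1 u.2.2 u.1.2 s).1)) }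

end Splitting

theorem alphaR_eq_psi_mul_alphaP (n t : ℕ) (hn : 1 ≤ n) (ht : 1 ≤ t)
    (P : Type) [Fintype P] [PartialOrder P] [BoundedOrder P] (rk : P → ℕ)
    (hrk_bot : rk ⊥ = 0) (hrk_top : rk ⊤ = n + 1)
    (hgraded : ∀ x y : P, x ⋖ y → rk y = rk x + 1)
    (G : Type) [Group G] [Fintype G] [MulAction G P]
    (hact : ∀ (g : G) (x y : P), x ≤ y → g • x ≤ g • y)
    (S : Finset ℕ) (hS : S ⊆ Finset.Icc 1 n) (g : G) :
    (alphaR P G rk t n S g : ℤ) = (psi S).eval (t : ℤ) * (alphaP P G rk S g : ℤ) := by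
  have hTN : ∀ s ∈ insert 0 (insert (n + 1) S), s ≤ n + 1 := by
    intro s hs
    rcases Finset.mem_insert.1 hs with rfl | hs
    · omega
    rcases Finset.mem_insert.1 hs with rfl | hs
    · exact le_rfl
    · have := (Finset.mem_Icc.1 (hS hs)).2
      omega
  have hAP : {x : P | rk x ∈ S ∨ x = ⊥ ∨ x = ⊤} =
      {x | rk x ∈ insert 0 (insert (n + 1) S)} := by
    ext x
    simp only [Set.mem_ofPred_eq, Finset.mem_insert, rank_eq_zero_iff_eq_bot hrk_bot hgraded,
      rank_eq_top_iff_eq_top hrk_top hgraded]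
    tauto
  have hAR : {x : RType P rk t n | RRank P rk t n x ∈ S ∨ x = none ∨ x = some none} =
      {x | RRank P rk t n x ∈ insert 0 (insert (n + 1) S)} := by
    ext x
    rcases x with _ | _ | c
    · simp [RRank]
    · simp [RRank]
    · have := c.2.2.2.2
      have := rank_lt_of_ne_top hrk_top hgraded c.2.1
      have h0 : rk c.val.1 ≠ 0 := by omega
      have hn : rk c.val.1 ≠ n + 1 := by omega
      simp [RRank, h0, hn]
  have hP : alphaP P G rk S g = Nat.card (rankSections (· ≤ ·) rk (insert 0 (insert (n + 1) S))
      (fun x : P => g • x = x) ⊥) := by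
    rw [alphaP, hAP]
    exact nFixedMaxChains_eq_card_rankSections _ le_refl (fun _ _ _ => le_trans)
      (fun x y h hne => rank_lt_of_lt hgraded (lt_of_le_of_ne h hne)) (by simp) (by simp) hTN
      hrk_bot (fun _ => bot_le) hrk_top (fun _ => le_top)
      (fun x y s h hx hy => exists_rank_eq_between hgraded h hx.le hy.le)
  have hR : alphaR P G rk t n S g = Nat.card (rankSections (RLe P rk t n) (RRank P rk t n)
      (insert 0 (insert (n + 1) S)) (RFix P G rk t n g) none) := by
    rw [alphaR, hAR]
    refine nFixedMaxChains_eq_card_rankSections (m := some none) _ RLe_refl RLe_trans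
      (RRank_lt hrk_top hgraded) (by simp) (by simp) hTN rfl (fun _ => trivial) rfl ?_
      (exists_RRank_eq_between hrk_bot hrk_top hgraded)
    rintro (_ | _ | c)
    · trivial
    · rfl
    · trivial
  rw [hP, hR, Nat.card_congr (rankSectionsEquivProd hrk_bot hrk_top hgraded hact hS g),
    Nat.card_prod, Nat.cast_mul, eval_psi hS]

end
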